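/- Given a commutative diagram of abelian groups with exact rows, consisting of maps f : A → B, g : B → C, f' : A' → B', g' : B' → C' and vertical maps α : A → A', β : B → B', γ : C → C' satisfying β ∘ f = f' ∘ α and γ ∘ g = g' ∘ β, with im f = ker g and im f' = ker g', there exists a homomorphism δ : (ker γ ∩ im g) → A' / (im α + ker f') such that the sequence 0 → ker f → ker(f' ∘ α) → ker β → ker γ ∩ im g →δ→ A'/(im α + ker f') → coker β → coker(γ ∘ g) → coker g' → 0 is exact, where the maps between kernels are induced by f and g and the maps between cokernels are induced by f' and g'. -/

import Mathlib

/-- Generalized Snake Lemma: for a commutative diagram of abelian groups with rows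
exact at the middle terms, there is a nine-term exact sequence
`0 → ker f → ker (f' ∘ α) → ker β → ker γ ∩ im g → A'/(im α + ker f')
   → coker β → coker (γ ∘ g) → coker g' → 0`. -/
theorem snake_lemma_generalized
    {A B C A' B' C' : Type*} [AddCommGroup A] [AddCommGroup B] [AddCommGroup C]
    [AddCommGroup A'] [AddCommGroup B'] [AddCommGroup C']
    (f : A →+ B) (g : B →+ C) (f' : A' →+ B') (g' : B' →+ C')
    (α : A →+ A') (β : B →+ B') (γ : C →+ C')
    (hcomm1 : β.comp f = f'.comp α) (hcomm2 : γ.comp g = g'.comp β)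
    (hrow : f.range = g.ker) (hrow' : f'.range = g'.ker) :
    ∃ (i1 : f.ker →+ (f'.comp α).ker)
      (i2 : (f'.comp α).ker →+ β.ker)
      (i3 : β.ker →+ (γ.ker ⊓ g.range : AddSubgroup C))
      (δ : (γ.ker ⊓ g.range : AddSubgroup C) →+ A' ⧸ (α.range ⊔ f'.ker))
      (p1 : (A' ⧸ (α.range ⊔ f'.ker)) →+ B' ⧸ β.range)
      (p2 : (B' ⧸ β.range) →+ C' ⧸ (γ.comp g).range)
      (p3 : (C' ⧸ (γ.comp g).range) →+ C' ⧸ g'.range),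
      (∀ x : f.ker, (i1 x : A) = (x : A)) ∧
      (∀ x : (f'.comp α).ker, (i2 x : B) = f (x : A)) ∧
      (∀ x : β.ker, (i3 x : C) = g (x : B)) ∧
      (∀ a' : A', p1 (QuotientAddGroup.mk a') = QuotientAddGroup.mk (f' a')) ∧
      (∀ b' : B', p2 (QuotientAddGroup.mk b') = QuotientAddGroup.mk (g' b')) ∧
      (∀ c' : C', p3 (QuotientAddGroup.mk c') = QuotientAddGroup.mk c') ∧
      Function.Injective i1 ∧
      Function.Exact i1 i2 ∧
      Function.Exact i2 i3 ∧
      Function.Exact i3 δ ∧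
      Function.Exact δ p1 ∧
      Function.Exact p1 p2 ∧
      Function.Exact p2 p3 ∧
      Function.Surjective p3 := by
  have h1 : ∀ a, β (f a) = f' (α a) := fun a => DFunLike.congr_fun hcomm1 a
  have h2 : ∀ b, γ (g b) = g' (β b) := fun b => DFunLike.congr_fun hcomm2 b
  have r1 : ∀ b, g b = 0 → ∃ a, f a = b := fun b hb => by
    have : b ∈ f.range := by rw [hrow]; exact hb
    exact this
  have r1' : ∀ a, g (f a) = 0 := fun a => by
    have : f a ∈ g.ker := by rw [← hrow]; exact ⟨a, rfl⟩
    exact this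
  have r2 : ∀ b, g' b = 0 → ∃ a, f' a = b := fun b hb => by
    have : b ∈ f'.range := by rw [hrow']; exact hb
    exact this
  have r2' : ∀ a, g' (f' a) = 0 := fun a => by
    have : f' a ∈ g'.ker := by rw [← hrow']; exact ⟨a, rfl⟩
    exact this
  have memS : ∀ x : A', x ∈ α.range ⊔ f'.ker ↔ ∃ a, f' x = f' (α a) := by
    intro x
    rw [AddSubgroup.mem_sup]
    constructor
    · rintro ⟨_, ⟨a, rfl⟩, z, hz, rfl⟩
      have hz : f' z = 0 := hz
      exact ⟨a, by simp [hz]⟩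
    · rintro ⟨a, ha⟩
      refine ⟨α a, ⟨a, rfl⟩, x - α a, ?_, by abel⟩
      show f' (x - α a) = 0
      rw [map_sub, ha, sub_self]
  have ex : ∀ c : (γ.ker ⊓ g.range : AddSubgroup C), ∃ p : B × A', g p.1 = c ∧ f' p.2 = β p.1 := by
    rintro ⟨c, hc, b, rfl⟩
    have hc : γ (g b) = 0 := hc
    obtain ⟨a', ha'⟩ := r2 (β b) (by rw [← h2, hc])
    exact ⟨(b, a'), rfl, ha'⟩
  choose s hs1 hs2 using ex
  have uniq : ∀ b₁ b₂ a₁ a₂, g b₁ = g b₂ → f' a₁ = β b₁ → f' a₂ = β b₂ →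
      (QuotientAddGroup.mk a₁ : A' ⧸ (α.range ⊔ f'.ker)) = QuotientAddGroup.mk a₂ := by
    intro b₁ b₂ a₁ a₂ hg e₁ e₂
    rw [QuotientAddGroup.eq, memS]
    obtain ⟨a, ha⟩ := r1 (-b₁ + b₂) (by simp [hg])
    exact ⟨a, by rw [← h1, ha]; simp [e₁, e₂]⟩
  let δ : (γ.ker ⊓ g.range : AddSubgroup C) →+ A' ⧸ (α.range ⊔ f'.ker) :=
    AddMonoidHom.mk' (fun c => QuotientAddGroup.mk (s c).2) (by
      intro c d
      rw [← QuotientAddGroup.mk_add]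
      exact uniq (s (c + d)).1 ((s c).1 + (s d).1) _ _ (by simp [hs1]) (hs2 _) (by simp [hs2]))
  have hδ : ∀ c b a', g b = c.1 → f' a' = β b → δ c = QuotientAddGroup.mk a' := by
    intro c b a' hb ha
    exact uniq _ _ _ _ ((hs1 c).trans hb.symm) (hs2 c) ha
  let i1 : f.ker →+ (f'.comp α).ker :=
    AddSubgroup.inclusion (fun x hx => by
      have hx : f x = 0 := hx
      show f' (α x) = 0
      rw [← h1, hx, map_zero])
  let i2 : (f'.comp α).ker →+ β.ker :=
    (f.comp (f'.comp α).ker.subtype).codRestrict β.ker (fun x => by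
      show β (f x) = 0
      rw [h1]; exact x.2)
  let i3 : β.ker →+ (γ.ker ⊓ g.range : AddSubgroup C) :=
    (g.comp β.ker.subtype).codRestrict _ (fun x => by
      have hx : β x = 0 := x.2
      refine ⟨?_, ⟨x, rfl⟩⟩
      show γ (g x) = 0
      rw [h2, hx, map_zero])
  let p1 : (A' ⧸ (α.range ⊔ f'.ker)) →+ B' ⧸ β.range :=
    QuotientAddGroup.map _ _ f' (fun x hx => by
      obtain ⟨a, ha⟩ := (memS x).1 hx
      exact ⟨f a, by rw [h1, ha]⟩)
  let p2 : (B' ⧸ β.range) →+ C' ⧸ (γ.comp g).range :=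
    QuotientAddGroup.map _ _ g' (by
      rintro _ ⟨b, rfl⟩
      exact ⟨b, h2 b⟩)
  let p3 : (C' ⧸ (γ.comp g).range) →+ C' ⧸ g'.range :=
    QuotientAddGroup.map _ _ (AddMonoidHom.id C') (by
      rintro _ ⟨b, rfl⟩
      exact ⟨β b, (h2 b).symm⟩)
  have e1 : ∀ x : f.ker, (i1 x : A) = (x : A) := fun _ => rfl
  have e2 : ∀ x : (f'.comp α).ker, (i2 x : B) = f (x : A) := fun _ => rfl
  have e3 : ∀ x : β.ker, (i3 x : C) = g (x : B) := fun _ => rfl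
  have q1 : ∀ a' : A', p1 (QuotientAddGroup.mk a') = QuotientAddGroup.mk (f' a') := fun _ => rfl
  have q2 : ∀ b' : B', p2 (QuotientAddGroup.mk b') = QuotientAddGroup.mk (g' b') := fun _ => rfl
  have q3 : ∀ c' : C', p3 (QuotientAddGroup.mk c') = QuotientAddGroup.mk c' := fun _ => rfl
  refine ⟨i1, i2, i3, δ, p1, p2, p3, e1, e2, e3, q1, q2, q3, ?_, ?_, ?_, ?_, ?_, ?_, ?_, ?_⟩
  · intro x y h
    apply Subtype.ext
    rw [← e1, ← e1, h]
  · intro x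
    constructor
    · intro h
      have hx : f x = 0 := by rw [← e2, h]; rfl
      exact ⟨⟨x, hx⟩, Subtype.ext rfl⟩
    · rintro ⟨y, rfl⟩
      exact Subtype.ext y.2
  · intro x
    constructor
    · intro h
      have hx : g x = 0 := by rw [← e3, h]; rfl
      obtain ⟨a, ha⟩ := r1 _ hx
      refine ⟨⟨a, ?_⟩, Subtype.ext ha⟩
      show f' (α a) = 0
      rw [← h1, ha]; exact x.2
    · rintro ⟨y, rfl⟩
      exact Subtype.ext (r1' y)
  · intro c
    constructor
    · intro h
      have h : (QuotientAddGroup.mk (s c).2 : A' ⧸ (α.range ⊔ f'.ker)) = 0 := h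
      rw [QuotientAddGroup.eq_zero_iff, memS] at h
      obtain ⟨a, ha⟩ := h
      refine ⟨⟨(s c).1 - f a, ?_⟩, Subtype.ext ?_⟩
      · show β ((s c).1 - f a) = 0
        rw [map_sub, h1, ← ha, hs2, sub_self]
      · rw [e3]
        simp [r1', hs1]
    · rintro ⟨y, rfl⟩
      have hy : β y = 0 := y.2
      rw [hδ (i3 y) y 0 rfl (by rw [hy, map_zero])]
      rfl
  · intro x
    obtain ⟨a', rfl⟩ := QuotientAddGroup.mk_surjective x
    constructor
    · intro h
      rw [q1, QuotientAddGroup.eq_zero_iff] at h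
      obtain ⟨b, hb⟩ := h
      refine ⟨⟨g b, ?_, ⟨b, rfl⟩⟩, hδ _ b a' rfl hb.symm⟩
      show γ (g b) = 0
      rw [h2, hb, r2']
    · rintro ⟨c, hc⟩
      rw [← hc, hδ c _ _ (hs1 c) (hs2 c), q1, QuotientAddGroup.eq_zero_iff]
      exact ⟨_, (hs2 c).symm⟩
  · intro x
    obtain ⟨b', rfl⟩ := QuotientAddGroup.mk_surjective x
    constructor
    · intro h
      rw [q2, QuotientAddGroup.eq_zero_iff] at h
      obtain ⟨b, hb⟩ := h
      have hb : γ (g b) = g' b' := hb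
      obtain ⟨a', ha'⟩ := r2 (b' - β b) (by rw [map_sub, ← h2, hb, sub_self])
      refine ⟨QuotientAddGroup.mk a', ?_⟩
      rw [q1, QuotientAddGroup.eq, ha']
      exact ⟨b, by abel⟩
    · rintro ⟨y, hy⟩
      obtain ⟨a', rfl⟩ := QuotientAddGroup.mk_surjective y
      rw [← hy, q1, q2, r2']
      rfl
  · intro x
    obtain ⟨c', rfl⟩ := QuotientAddGroup.mk_surjective x
    constructor
    · intro h
      rw [q3, QuotientAddGroup.eq_zero_iff] at h
      obtain ⟨b', hb⟩ := h
      exact ⟨QuotientAddGroup.mk b', by rw [q2, hb]⟩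
    · rintro ⟨y, hy⟩
      obtain ⟨b', rfl⟩ := QuotientAddGroup.mk_surjective y
      rw [← hy, q2, q3, QuotientAddGroup.eq_zero_iff]
      exact ⟨b', rfl⟩
  · intro x
    obtain ⟨c', rfl⟩ := QuotientAddGroup.mk_surjective x
    exact ⟨QuotientAddGroup.mk c', q3 c'⟩
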